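/- Let L > 1 be a real number, (n_j) a sequence of positive integers with n_j → ∞, and (k_j) a sequence in ℂ with Im k_j → 0 and k_j/n_j → L as j → ∞. Then k_j · B_{n_j}(k_j) → (1/π) ∫_1^L ((t/L) + 1)/√(t² − 1) dt as j → ∞. In particular, B_{n_j}(k_j) ≠ 0 for all sufficiently large j. -/

import Mathlib

open MeasureTheory intervalIntegral Complex Filter

/-- Bessel function of the first kind of integer order `n`. -/
noncomputable def besselJ (n : ℕ) (z : ℂ) : ℂ :=
  ∑' m : ℕ, ((-1) ^ m / ((Nat.factorial m : ℂ) * (Nat.factorial (m + n) : ℂ))) *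
    (z / 2) ^ (2 * m + n)

/-- `B_n(k) = ∫_0^1 (t+1) J_n(kt)^2 dt`. -/
noncomputable def BornB (n : ℕ) (k : ℂ) : ℂ :=
  ∫ t in (0:ℝ)..1, ((t : ℂ) + 1) * (besselJ n (k * t)) ^ 2
lemma hs_cong {ι : Type*} {f g : ι → ℂ} {a b : ℂ} (h : HasSum f a) (hf : ∀ i, g i = f i)
    (hab : b = a) : HasSum g b := by
  rw [hab, funext hf]; exact h

open Real in
lemma int_exp_int (m : ℤ) :
    ∫ τ in (0:ℝ)..(2*π), Complex.exp (m * Complex.I * τ) = if m = 0 then (2*π : ℂ) else 0 := by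
  split_ifs with h
  · subst h; simp
  · have hc : (m * Complex.I : ℂ) ≠ 0 := by simp [h]
    rw [integral_exp_mul_complex hc]
    have : Complex.exp (m * Complex.I * ((2*π : ℝ) : ℂ)) = 1 := by
      rw [Complex.exp_eq_one_iff]; exact ⟨m, by push_cast; ring⟩
    rw [this]; simp

lemma summable_norm_exp (x : ℂ) : Summable (fun a : ℕ => ‖x ^ a / (a.factorial : ℂ)‖) := by
  have := Real.summable_pow_div_factorial ‖x‖
  refine this.congr fun a => ?_
  simp

open Real in
/-- integral representation -/
lemma besselJ_hasSum (n : ℕ) (z : ℂ) :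
    HasSum (fun m : ℕ => ((-1) ^ m / ((Nat.factorial m : ℂ) * (Nat.factorial (m + n) : ℂ))) *
      (z / 2) ^ (2 * m + n))
      ((1 / (2*π : ℂ)) * ∫ τ in (0:ℝ)..(2*π),
        Complex.exp (Complex.I * (z * Real.sin τ - n * τ))) := by
  set T : ℕ × ℕ → ℂ := fun p => ((z/2) ^ p.1 / (p.1.factorial : ℂ)) *
    ((-(z/2)) ^ p.2 / (p.2.factorial : ℂ)) with hT
  set F : ℕ × ℕ → ℝ → ℂ := fun p τ => T p * Complex.exp (((p.1 - p.2 - n : ℤ) : ℂ) * Complex.I * τ)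
    with hF
  have hTs : Summable (fun p => ‖T p‖) := by
    have := (summable_norm_exp (z/2)).mul_of_nonneg (summable_norm_exp (-(z/2)))
      (fun _ => norm_nonneg _) (fun _ => norm_nonneg _)
    refine this.congr fun p => ?_
    simp [hT]
  have hFn : ∀ p τ, ‖F p τ‖ = ‖T p‖ := by
    intro p τ
    have : (((p.1 - p.2 - n : ℤ) : ℂ) * Complex.I * τ) = (((p.1 - p.2 - n : ℤ) : ℝ) * τ : ℝ) * Complex.I := by
      push_cast; ring
    simp only [hF, norm_mul, this, Complex.norm_exp_ofReal_mul_I, mul_one]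
  have hFc : ∀ p, Continuous (F p) := by
    intro p; simp only [hF]; fun_prop
  have hFsum : ∀ τ : ℝ, HasSum (fun p => F p τ) (Complex.exp (Complex.I * (z * Real.sin τ - n * τ))) := by
    intro τ
    have h1 : HasSum (fun a : ℕ => (z/2 * Complex.exp (τ * Complex.I)) ^ a / (a.factorial : ℂ))
        (Complex.exp (z/2 * Complex.exp (τ * Complex.I))) := by
      rw [Complex.exp_eq_exp_ℂ]; exact NormedSpace.expSeries_div_hasSum_exp _
    have h2 : HasSum (fun a : ℕ => (-(z/2) * Complex.exp (-(τ * Complex.I))) ^ a / (a.factorial : ℂ))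
        (Complex.exp (-(z/2) * Complex.exp (-(τ * Complex.I)))) := by
      rw [Complex.exp_eq_exp_ℂ]; exact NormedSpace.expSeries_div_hasSum_exp _
    have hs1 := summable_norm_exp (z/2 * Complex.exp (τ * Complex.I))
    have hs2 := summable_norm_exp (-(z/2) * Complex.exp (-(τ * Complex.I)))
    have hs3 := summable_mul_of_summable_norm hs1 hs2
    have h3 := h1.mul h2 hs3
    have h4 := h3.mul_right (Complex.exp (-(n * τ * Complex.I)))
    refine hs_cong h4 ?_ ?_
    · intro p
      simp only [hF, hT, mul_pow, ← Complex.exp_nat_mul]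
      have : Complex.exp (((p.1 - p.2 - n : ℤ) : ℂ) * Complex.I * τ) =
        Complex.exp (p.1 * (τ * Complex.I)) * Complex.exp (p.2 * (-(τ * Complex.I))) *
          Complex.exp (-(n * τ * Complex.I)) := by
        rw [← Complex.exp_add, ← Complex.exp_add]; congr 1; push_cast; ring
      rw [this]; ring
    · rw [← Complex.exp_add, ← Complex.exp_add]; congr 1
      have : (Real.sin τ : ℂ) = (Complex.exp (-(τ * Complex.I)) - Complex.exp (τ * Complex.I)) * Complex.I / 2 := by
        rw [Complex.ofReal_sin, Complex.sin]; ring_nf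
      rw [this]
      linear_combination (z/2 * (Complex.exp (-(τ * Complex.I)) - Complex.exp (τ * Complex.I))) * Complex.I_sq
  have hpi : (0:ℝ) ≤ 2*π := by positivity
  have hintg : HasSum (fun p => ∫ τ in (0:ℝ)..(2*π), F p τ)
      (∫ τ in (0:ℝ)..(2*π), Complex.exp (Complex.I * (z * Real.sin τ - n * τ))) := by
    simp only [intervalIntegral.integral_of_le hpi]
    have := hasSum_integral_of_summable_integral_norm (μ := volume.restrict (Set.Ioc 0 (2*π))) (F := F)
      (fun p => (hFc p).integrableOn_Ioc) ?_
    · refine hs_cong this (fun _ => rfl) ?_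
      congr 1; ext τ; exact (hFsum τ).tsum_eq.symm
    · simp only [hFn]
      simp only [MeasureTheory.integral_const, smul_eq_mul]
      exact hTs.mul_left _
  have hval : ∀ p : ℕ × ℕ, ∫ τ in (0:ℝ)..(2*π), F p τ = T p * (if (p.1 - p.2 - n : ℤ) = 0 then (2*π : ℂ) else 0) := by
    intro p
    simp only [hF]
    rw [intervalIntegral.integral_const_mul, int_exp_int]
  simp only [hval] at hintg
  have hinj : Function.Injective (fun m : ℕ => (m + n, m)) := by
    intro a b h; simpa using congrArg Prod.snd h
  rw [← hinj.hasSum_iff] at hintg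
  · have := hintg.mul_left (1 / (2*π : ℂ))
    refine hs_cong this (fun m => ?_) rfl
    have hp : (π : ℂ) ≠ 0 := by exact_mod_cast Real.pi_ne_zero
    have hm : (m.factorial : ℂ) ≠ 0 := by exact_mod_cast m.factorial_ne_zero
    have hm' : ((m+n).factorial : ℂ) ≠ 0 := by exact_mod_cast (m+n).factorial_ne_zero
    simp only [Function.comp, hT]
    rw [if_pos (by push_cast; ring), neg_pow (z/2)]
    generalize z / 2 = y
    field_simp
    ring
  · rintro ⟨a, b⟩ h
    rw [if_neg, mul_zero]
    intro h'
    apply h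
    exact ⟨b, by ext <;> simp; omega⟩

open Real in
lemma besselJ_eq (n : ℕ) (z : ℂ) : besselJ n z = (1 / (2*π : ℂ)) * ∫ τ in (0:ℝ)..(2*π),
        Complex.exp (Complex.I * (z * Real.sin τ - n * τ)) :=
  (besselJ_hasSum n z).tsum_eq

lemma norm_besselJ_le (n : ℕ) (z : ℂ) : ‖besselJ n z‖ ≤ Real.exp |z.im| := by
  have hpi := Real.pi_pos
  rw [besselJ_eq, norm_mul]
  have h : ‖∫ τ in (0:ℝ)..(2*Real.pi), Complex.exp (Complex.I * (z * Real.sin τ - n * τ))‖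
      ≤ Real.exp |z.im| * |2 * Real.pi - 0| := by
    apply intervalIntegral.norm_integral_le_of_norm_le_const
    intro τ _
    rw [Complex.norm_exp]
    apply Real.exp_le_exp.2
    have : (Complex.I * (z * Real.sin τ - n * τ)).re = -(z.im * Real.sin τ) := by
      simp [-Complex.ofReal_sin]
    rw [this]
    calc -(z.im * Real.sin τ) ≤ |z.im * Real.sin τ| := neg_le_abs _
      _ = |z.im| * |Real.sin τ| := abs_mul _ _
      _ ≤ |z.im| * 1 := by gcongr; exact Real.abs_sin_le_one τ
      _ = _ := mul_one _
  have h2 : ‖(1 / (2*Real.pi) : ℂ)‖ = 1 / (2*Real.pi) := by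
    simp [abs_of_pos hpi]
  rw [sub_zero, abs_of_pos (show (0:ℝ) < 2*Real.pi by positivity)] at h
  rw [h2]
  calc _ ≤ 1 / (2*Real.pi) * (Real.exp |z.im| * (2*Real.pi)) := by gcongr
    _ = _ := by field_simp

lemma besselJ_differentiable (n : ℕ) : Differentiable ℂ (besselJ n) := by
  have hball : ∀ R : ℝ, DifferentiableOn ℂ (besselJ n) (Metric.ball 0 R) := by
    intro R
    unfold besselJ
    refine Complex.differentiableOn_tsum_of_summable_norm
      (u := fun m : ℕ => ((R/2)^2) ^ m / m.factorial * (|R|/2)^n) ?_ ?_ Metric.isOpen_ball ?_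
    · exact (Real.summable_pow_div_factorial _).mul_right _
    · intro m; fun_prop
    · intro m w hw
      have hw' : ‖w‖ ≤ |R| := by
        have : ‖w‖ < R := by simpa using hw
        exact this.le.trans (le_abs_self _)
      rw [norm_mul, norm_div, norm_pow, norm_pow, norm_mul, norm_neg, norm_one, one_pow]
      simp only [Complex.norm_natCast, norm_div, Complex.norm_ofNat]
      have h1 : (1:ℝ) ≤ (m+n).factorial := by exact_mod_cast (m+n).factorial_pos
      have h2 : (0:ℝ) < m.factorial := by exact_mod_cast m.factorial_pos
      calc (1 / ((m.factorial:ℝ) * (m+n).factorial)) * (‖w‖/2)^(2*m+n)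
          ≤ (1 / ((m.factorial:ℝ) * 1)) * (|R|/2)^(2*m+n) := by gcongr
        _ = _ := by
          rw [pow_add, pow_mul, div_pow |R|, sq_abs, ← div_pow]; ring
  intro z
  exact (hball (‖z‖+1)).differentiableAt (Metric.isOpen_ball.mem_nhds (by simp))

lemma reduce_real (n : ℕ) (k : ℂ) (hk : |k.im| ≤ 1) :
    ‖k * BornB n k - (k.re : ℂ) * BornB n (k.re : ℂ)‖ ≤ 3 * Real.exp 2 * |k.im| := by
  have hdiff : Differentiable ℂ (fun z => besselJ n z ^ 2) := (besselJ_differentiable n).pow 2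
  obtain ⟨G, hG⟩ := hdiff.isExactOn_univ
  replace hG : ∀ z, HasDerivAt G (besselJ n z ^ 2) z := fun z => hG z (Set.mem_univ z)
  have hGc : Continuous G := continuous_iff_continuousAt.2 fun z => (hG z).continuousAt
  have hJc : Continuous (besselJ n) := (besselJ_differentiable n).continuous
  have key : ∀ k : ℂ, k * BornB n k = 2 * G k - G 0 - ∫ t in (0:ℝ)..1, G (k * t) := by
    intro k
    have hd : ∀ t ∈ Set.uIcc (0:ℝ) 1, HasDerivAt (fun t : ℝ => ((t:ℂ) + 1) * G (k * t))
        (G (k * t) + k * (((t:ℂ) + 1) * besselJ n (k * t) ^ 2)) t := by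
      intro t _
      have h1 : HasDerivAt (fun t : ℝ => (t:ℂ) + 1) 1 t :=
        (Complex.ofRealCLM.hasDerivAt (x := t)).add_const 1
      have h2 : HasDerivAt (fun t : ℝ => k * (t:ℂ)) (k * 1) t :=
        (Complex.ofRealCLM.hasDerivAt (x := t)).const_mul k
      have h3 : HasDerivAt (fun t : ℝ => G (k * t)) _ t := (hG (k * t)).comp t h2
      exact (h1.fun_mul h3).congr_deriv (by ring)
    have hc1 : Continuous (fun t : ℝ => G (k * t)) := by fun_prop
    have hc2 : Continuous (fun t : ℝ => k * (((t:ℂ) + 1) * besselJ n (k * t) ^ 2)) := by fun_prop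
    have := intervalIntegral.integral_eq_sub_of_hasDerivAt hd ((hc1.add hc2).intervalIntegrable _ _)
    rw [intervalIntegral.integral_add (hc1.intervalIntegrable _ _) (hc2.intervalIntegrable _ _),
      intervalIntegral.integral_const_mul] at this
    unfold BornB
    simp only [Complex.ofReal_one, Complex.ofReal_zero, mul_one, mul_zero, zero_add, one_mul] at this
    linear_combination this
  have hLip : ∀ z : ℂ, |z.im| ≤ 1 → ‖G z - G (z.re : ℂ)‖ ≤ Real.exp 2 * |z.im| := by
    intro z hz
    have hconv : Convex ℝ {w : ℂ | |w.im| ≤ 1} := by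
      have : {w : ℂ | |w.im| ≤ 1} = Complex.imLm ⁻¹' (Set.Icc (-1) 1) := by
        ext w; simp [abs_le]
      rw [this]
      exact (convex_Icc _ _).linear_preimage _
    have := Convex.norm_image_sub_le_of_norm_hasDerivWithin_le (f := G)
      (f' := fun z => besselJ n z ^ 2) (s := {w : ℂ | |w.im| ≤ 1}) (C := Real.exp 2)
      (x := (z.re : ℂ)) (y := z) (fun w _ => (hG w).hasDerivWithinAt) ?_ hconv (by simp) hz
    · refine this.trans_eq ?_
      congr 1
      have : z - (z.re : ℂ) = z.im * Complex.I := by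
        apply Complex.ext <;> simp
      rw [this]; simp
    · intro w hw
      have h1 := norm_besselJ_le n w
      rw [norm_pow]
      calc ‖besselJ n w‖ ^ 2 ≤ (Real.exp |w.im|) ^ 2 := by gcongr
        _ = Real.exp (2 * |w.im|) := by rw [← Real.exp_nat_mul]; norm_num
        _ ≤ Real.exp 2 := by
          apply Real.exp_le_exp.2
          have : |w.im| ≤ 1 := hw
          linarith
  rw [key, key]
  have hintg : ‖(∫ t in (0:ℝ)..1, G (k * t)) - ∫ t in (0:ℝ)..1, G ((k.re:ℂ) * t)‖ ≤
      Real.exp 2 * |k.im| := by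
    have hc1 : Continuous (fun t : ℝ => G (k * t)) := by fun_prop
    have hc2 : Continuous (fun t : ℝ => G ((k.re:ℂ) * t)) := by fun_prop
    rw [← intervalIntegral.integral_sub (hc1.intervalIntegrable _ _) (hc2.intervalIntegrable _ _)]
    have := intervalIntegral.norm_integral_le_of_norm_le_const (a := 0) (b := 1)
      (f := fun t : ℝ => G (k * t) - G ((k.re:ℂ) * t)) (C := Real.exp 2 * |k.im|) ?_
    · simpa using this
    · intro t ht
      rw [Set.uIoc_of_le zero_le_one] at ht
      have him : (k * (t:ℂ)).im = k.im * t := by simp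
      have hre : (k * (t:ℂ)).re = k.re * t := by simp
      have hle : |k.im * t| ≤ |k.im| := by
        rw [abs_mul, abs_of_pos ht.1]
        exact mul_le_of_le_one_right (abs_nonneg _) ht.2
      have := hLip (k * t) (by rw [him]; linarith)
      rw [him, hre, Complex.ofReal_mul] at this
      exact this.trans (by gcongr)
  have h1 := hLip k hk
  calc _ = ‖2 * (G k - G (k.re:ℂ)) - ((∫ t in (0:ℝ)..1, G (k * t)) - ∫ t in (0:ℝ)..1, G ((k.re:ℂ) * t))‖ := by
        congr 1; ring
    _ ≤ ‖2 * (G k - G (k.re:ℂ))‖ + ‖(∫ t in (0:ℝ)..1, G (k * t)) - ∫ t in (0:ℝ)..1, G ((k.re:ℂ) * t)‖ :=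
        norm_sub_le _ _
    _ ≤ 2 * (Real.exp 2 * |k.im|) + Real.exp 2 * |k.im| := by
        rw [norm_mul, Complex.norm_ofNat]; gcongr
    _ = _ := by ring

open Real in
lemma besselJ_zero_shift (y d : ℝ) : ∫ τ in (0:ℝ)..(2*π), Complex.exp (Complex.I * (y * Real.cos (τ - d)))
    = 2 * π * besselJ 0 y := by
  have hp : (π : ℂ) ≠ 0 := by exact_mod_cast Real.pi_ne_zero
  rw [besselJ_eq]
  have hper : Function.Periodic (fun τ : ℝ => Complex.exp (Complex.I * (y * Real.sin τ))) (2*π) := by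
    intro τ; simp only [Real.sin_add_two_pi]
  have h1 : ∀ τ : ℝ, Real.cos (τ - d) = Real.sin (τ + (π/2 - d)) := by
    intro τ; rw [← Real.sin_add_pi_div_two]; ring_nf
  simp only [h1]
  rw [intervalIntegral.integral_comp_add_right
    (fun τ : ℝ => Complex.exp (Complex.I * (y * Real.sin τ)))]
  rw [add_comm (2*π) (π/2-d), zero_add, hper.intervalIntegral_add_eq _ 0, zero_add]
  simp only [Nat.cast_zero, zero_mul, sub_zero]
  field_simp

open Real in
lemma besselJ_sq (n : ℕ) (s : ℝ) : besselJ n s ^ 2 = (1 / (2*π : ℂ)) * ∫ φ in (0:ℝ)..(2*π),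
    besselJ 0 ((s * (2 * Real.sin (φ/2)) : ℝ) : ℂ) * Complex.exp (-(Complex.I * (n * φ))) := by
  have hp : (π : ℂ) ≠ 0 := by exact_mod_cast Real.pi_ne_zero
  set h : ℝ → ℂ := fun τ => Complex.exp (Complex.I * (s * Real.sin τ - n * τ)) with hh
  have hper : Function.Periodic h (2*π) := by
    intro τ
    simp only [hh, Real.sin_add_two_pi]
    rw [Complex.exp_eq_exp_iff_exists_int]
    exact ⟨-n, by push_cast; ring⟩
  have hc : Continuous h := by simp only [hh]; fun_prop
  have hJ : besselJ n s = (1 / (2*π : ℂ)) * ∫ τ in (0:ℝ)..(2*π), h τ := besselJ_eq n s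
  have hshift : ∀ τ : ℝ, ∫ φ in (0:ℝ)..(2*π), h (φ - τ) = ∫ φ in (0:ℝ)..(2*π), h φ := by
    intro τ
    rw [intervalIntegral.integral_comp_sub_right h, sub_eq_add_neg, sub_eq_add_neg, add_comm (2*π),
      zero_add, hper.intervalIntegral_add_eq _ 0, zero_add]
  have hsq : (∫ τ in (0:ℝ)..(2*π), h τ) ^ 2 = ∫ τ in (0:ℝ)..(2*π), ∫ φ in (0:ℝ)..(2*π), h τ * h (φ - τ) := by
    simp only [intervalIntegral.integral_const_mul, hshift, intervalIntegral.integral_mul_const]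
    ring
  have hswap : (∫ τ in (0:ℝ)..(2*π), ∫ φ in (0:ℝ)..(2*π), h τ * h (φ - τ)) =
      ∫ φ in (0:ℝ)..(2*π), ∫ τ in (0:ℝ)..(2*π), h τ * h (φ - τ) := by
    apply MeasureTheory.intervalIntegral_intervalIntegral_swap
    have hcc : Continuous (Function.uncurry fun τ φ : ℝ => h τ * h (φ - τ)) := by
      simp only [Function.uncurry_def]; fun_prop
    exact (hcc.continuousOn.integrableOn_compact (isCompact_uIcc.prod isCompact_uIcc)).mono_set
      (Set.prod_mono Set.uIoc_subset_uIcc Set.uIoc_subset_uIcc)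
  rw [hJ, mul_pow, hsq, hswap]
  have hin : ∀ φ : ℝ, ∫ τ in (0:ℝ)..(2*π), h τ * h (φ - τ) =
      2 * π * (besselJ 0 ((s * (2 * Real.sin (φ/2)) : ℝ) : ℂ) * Complex.exp (-(Complex.I * (n * φ)))) := by
    intro φ
    have : ∀ τ : ℝ, h τ * h (φ - τ) = Complex.exp (Complex.I * ((s * (2 * Real.sin (φ/2)) : ℝ) * Real.cos (τ - φ/2)))
        * Complex.exp (-(Complex.I * (n * φ))) := by
      intro τ
      simp only [hh]
      rw [← Complex.exp_add, ← Complex.exp_add]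
      congr 1
      have h1 : Real.sin τ + Real.sin (φ - τ) = 2 * Real.sin (φ/2) * Real.cos (τ - φ/2) := by
        have e1 := Real.sin_add (φ/2) (τ - φ/2)
        have e2 := Real.sin_sub (φ/2) (τ - φ/2)
        rw [show φ/2 + (τ - φ/2) = τ by ring] at e1
        rw [show φ/2 - (τ - φ/2) = φ - τ by ring] at e2
        linarith
      have h2 := congrArg (fun x : ℝ => (x : ℂ)) h1
      simp only [Complex.ofReal_add, Complex.ofReal_mul] at h2
      push_cast at h2 ⊢
      linear_combination Complex.I * s * h2
    simp only [this]
    rw [intervalIntegral.integral_mul_const, besselJ_zero_shift]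
    ring
  simp only [hin]
  rw [intervalIntegral.integral_const_mul]
  field_simp

lemma gauss_moment (p : ℝ) (hp : 0 < p) (m : ℕ) :
    IntegrableOn (fun s : ℝ => s ^ (2*m+1) * Real.exp (-p * s^2)) (Set.Ioi 0) ∧
    ∫ s in Set.Ioi (0:ℝ), s ^ (2*m+1) * Real.exp (-p * s^2) = m.factorial / (2 * p^(m+1)) := by
  constructor
  · have := integrable_rpow_mul_exp_neg_mul_sq hp (s := ((2*m+1 : ℕ) : ℝ))
      (lt_of_lt_of_le (by norm_num) (Nat.cast_nonneg _))
    simp only [Real.rpow_natCast] at this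
    exact this.integrableOn
  · have := _root_.integral_rpow_mul_exp_neg_mul_rpow (p := 2) (q := ((2*m+1 : ℕ) : ℝ)) (b := p) (by norm_num)
      (lt_of_lt_of_le (by norm_num) (Nat.cast_nonneg _)) hp
    simp only [Real.rpow_natCast, Real.rpow_two] at this
    rw [this]
    have h1 : -(((2*m+1 : ℕ) : ℝ) + 1) / 2 = -((m + 1 : ℕ) : ℝ) := by push_cast; ring
    have h2 : (((2*m+1 : ℕ) : ℝ) + 1) / 2 = (m : ℝ) + 1 := by push_cast; ring
    rw [h1, h2, Real.Gamma_nat_eq_factorial, Real.rpow_neg hp.le, Real.rpow_natCast]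
    field_simp

lemma hankel_zero (p : ℝ) (hp : 0 < p) (y : ℝ) :
    ∫ s in Set.Ioi (0:ℝ), ((s * Real.exp (-p * s^2) : ℝ) : ℂ) * besselJ 0 ((s * y : ℝ) : ℂ)
      = ((Real.exp (-(y^2/(4*p))) / (2*p) : ℝ) : ℂ) := by
  set c : ℕ → ℝ := fun m => (-1)^m / (m.factorial * m.factorial) * (y/2)^(2*m) with hc
  set F : ℕ → ℝ → ℂ := fun m s => ((c m * (s ^ (2*m+1) * Real.exp (-p * s^2)) : ℝ) : ℂ) with hF
  have hFi : ∀ m, Integrable (F m) (volume.restrict (Set.Ioi 0)) := fun m =>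
    (((gauss_moment p hp m).1.integrable).const_mul (c m)).ofReal
  have hFn : ∀ m, ∫ s in Set.Ioi (0:ℝ), ‖F m s‖ = (1/(2*p)) * ((y^2/(4*p))^m / m.factorial) := by
    intro m
    have : ∫ s in Set.Ioi (0:ℝ), ‖F m s‖ = ∫ s in Set.Ioi (0:ℝ), |c m| * (s ^ (2*m+1) * Real.exp (-p * s^2)) := by
      apply setIntegral_congr_fun measurableSet_Ioi
      intro s hs
      have hs' : 0 < s := hs
      simp only [hF, Complex.norm_real, Real.norm_eq_abs]
      rw [abs_mul, abs_of_pos (a := s ^ (2*m+1) * Real.exp (-p * s^2)) (by positivity)]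
    rw [this, MeasureTheory.integral_const_mul, (gauss_moment p hp m).2]
    have hf : (m.factorial : ℝ) ≠ 0 := by exact_mod_cast m.factorial_ne_zero
    have h3 : |c m| = 1 / (m.factorial * m.factorial) * (y^2/4)^m := by
      simp only [hc]
      rw [abs_mul, abs_div, abs_pow, abs_neg, abs_one, one_pow, pow_mul, div_pow]
      rw [abs_of_nonneg (a := (m.factorial : ℝ) * m.factorial) (by positivity),
        abs_of_nonneg (a := (y^2/2^2)^m) (by positivity)]
      norm_num
    rw [h3, show y^2/(4*p) = (y^2/4)/p by ring, div_pow (y^2/4)]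
    field_simp
    ring
  have hs := hasSum_integral_of_summable_integral_norm hFi (by
    simp only [hFn]; exact (Real.summable_pow_div_factorial _).mul_left _)
  have hsum : ∀ s : ℝ, ∑' m, F m s = ((s * Real.exp (-p * s^2) : ℝ) : ℂ) * besselJ 0 ((s * y : ℝ) : ℂ) := by
    intro s
    rw [besselJ, ← tsum_mul_left]
    congr 1; ext m
    simp only [hF, hc]
    push_cast
    rw [add_zero]
    ring
  simp only [hsum] at hs
  have hval : ∀ m, ∫ s in Set.Ioi (0:ℝ), F m s = (((1/(2*p)) * ((-(y^2/(4*p)))^m / m.factorial) : ℝ) : ℂ) := by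
    intro m
    simp only [hF]
    rw [integral_complex_ofReal, MeasureTheory.integral_const_mul, (gauss_moment p hp m).2]
    congr 1
    have hf : (m.factorial : ℝ) ≠ 0 := by exact_mod_cast m.factorial_ne_zero
    simp only [hc]
    rw [neg_pow (y^2/(4*p)), show y^2/(4*p) = (y^2/4)/p by ring, div_pow (y^2/4), pow_mul,
      show (y/2)^2 = y^2/4 by ring]
    field_simp
    ring
  simp only [hval] at hs
  have hs2 : HasSum (fun m : ℕ => (1/(2*p)) * ((-(y^2/(4*p)))^m / m.factorial)) ((1/(2*p)) * Real.exp (-(y^2/(4*p)))) := by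
    apply HasSum.mul_left
    rw [Real.exp_eq_exp_ℝ]; exact NormedSpace.expSeries_div_hasSum_exp _
  have hs3 := Complex.hasSum_ofReal.2 hs2
  rw [hs.unique hs3]
  congr 1; ring

open Real in
lemma gauss_besselJ_sq (n : ℕ) (p : ℝ) (hp : 0 < p) :
    ∫ s in Set.Ioi (0:ℝ), ((s * Real.exp (-p * s^2) : ℝ) : ℂ) * besselJ n s ^ 2
      = (1 / (2*π : ℂ)) * ∫ φ in (0:ℝ)..(2*π),
        ((Real.exp (-(Real.sin (φ/2)^2/p)) / (2*p) : ℝ) : ℂ) * Complex.exp (-(Complex.I * (n * φ))) := by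
  have hJc : Continuous (besselJ 0) := (besselJ_differentiable 0).continuous
  set f : ℝ → ℝ → ℂ := fun φ s => ((s * Real.exp (-p * s^2) : ℝ) : ℂ) *
    (besselJ 0 ((s * (2 * Real.sin (φ/2)) : ℝ) : ℂ) * Complex.exp (-(Complex.I * (n * φ)))) with hf
  have hfc : Continuous (Function.uncurry f) := by
    simp only [hf, Function.uncurry_def]; fun_prop
  have hpi : (0:ℝ) ≤ 2*π := by positivity
  have hintg : Integrable (Function.uncurry f)
      ((volume.restrict (Set.uIoc 0 (2*π))).prod (volume.restrict (Set.Ioi (0:ℝ)))) := by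
    have hg : Integrable (fun s : ℝ => s * Real.exp (-p * s^2)) (volume.restrict (Set.Ioi (0:ℝ))) :=
      (integrable_mul_exp_neg_mul_sq hp).integrableOn
    have h1 : Integrable (fun φ : ℝ => (1:ℝ)) (volume.restrict (Set.uIoc 0 (2*π))) := by
      rw [Set.uIoc_of_le hpi]
      exact integrable_const _
    refine (h1.mul_prod hg).mono hfc.aestronglyMeasurable ?_
    refine Eventually.of_forall fun ⟨φ, s⟩ => ?_
    simp only [Function.uncurry, hf, norm_mul, one_mul, Complex.norm_real]
    have e1 : ‖besselJ 0 ((s * (2 * Real.sin (φ/2)) : ℝ) : ℂ)‖ ≤ 1 := by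
      have := norm_besselJ_le 0 ((s * (2 * Real.sin (φ/2)) : ℝ) : ℂ)
      rw [Complex.ofReal_im] at this
      simpa using this
    have e2 : ‖Complex.exp (-(Complex.I * (n * φ)))‖ = 1 := by
      rw [Complex.norm_exp]; simp
    rw [e2, mul_one]
    have : 0 ≤ ‖s‖ * ‖Real.exp (-p * s^2)‖ := by positivity
    nlinarith
  have hsw := MeasureTheory.intervalIntegral_integral_swap hintg
  have hl : ∀ s : ℝ, ∫ φ in (0:ℝ)..(2*π), f φ s = ((s * Real.exp (-p * s^2) : ℝ) : ℂ) * ((2*π) * besselJ n s ^ 2) := by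
    intro s
    have hpc : (π : ℂ) ≠ 0 := by exact_mod_cast Real.pi_ne_zero
    simp only [hf]
    rw [intervalIntegral.integral_const_mul, besselJ_sq]
    field_simp
  have hr : ∀ φ : ℝ, ∫ s in Set.Ioi (0:ℝ), f φ s =
      ((Real.exp (-(Real.sin (φ/2)^2/p)) / (2*p) : ℝ) : ℂ) * Complex.exp (-(Complex.I * (n * φ))) := by
    intro φ
    have h0 : ∀ s : ℝ, f φ s = (((s * Real.exp (-p * s^2) : ℝ) : ℂ) *
        besselJ 0 ((s * (2 * Real.sin (φ/2)) : ℝ) : ℂ)) * Complex.exp (-(Complex.I * (n * φ))) := by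
      intro s; simp only [hf]; rw [mul_assoc]
    simp only [h0]
    rw [MeasureTheory.integral_mul_const, hankel_zero p hp (2 * Real.sin (φ/2))]
    have e : (2 * Real.sin (φ/2))^2/(4*p) = Real.sin (φ/2)^2/p := by field_simp; ring
    rw [e]
  simp only [hl, hr] at hsw
  rw [hsw]
  have hpc : (π : ℂ) ≠ 0 := by exact_mod_cast Real.pi_ne_zero
  rw [← MeasureTheory.integral_const_mul]
  congr 1; ext s
  field_simp

lemma besselJ_real (n : ℕ) (x : ℝ) : besselJ n (x : ℂ) = (((besselJ n (x : ℂ)).re : ℝ) : ℂ) := by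
  have : besselJ n (x : ℂ) = ((∑' m : ℕ, ((-1) ^ m / ((Nat.factorial m : ℝ) * (Nat.factorial (m + n) : ℝ))) *
    (x / 2) ^ (2 * m + n) : ℝ) : ℂ) := by
    rw [besselJ, Complex.ofReal_tsum]
    congr 1; ext m; push_cast; rfl
  rw [this, Complex.ofReal_re]

/-- real Bessel function -/
noncomputable def Jr (n : ℕ) (x : ℝ) : ℝ := (besselJ n (x : ℂ)).re

lemma Jr_ofReal (n : ℕ) (x : ℝ) : ((Jr n x : ℝ) : ℂ) = besselJ n (x : ℂ) := (besselJ_real n x).symm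

lemma Jr_continuous (n : ℕ) : Continuous (Jr n) := by
  have hJc : Continuous (besselJ n) := (besselJ_differentiable n).continuous
  unfold Jr; fun_prop

lemma Jr_abs_le (n : ℕ) (x : ℝ) : |Jr n x| ≤ 1 := by
  have := norm_besselJ_le n (x : ℂ)
  rw [← Jr_ofReal, Complex.norm_real, Complex.ofReal_im] at this
  simpa using this

/-- weight -/
noncomputable def wt (n : ℕ) (σ : ℝ) : ℝ := n * σ * Jr n (n * σ) ^ 2

open Real in
lemma moment_formula (n : ℕ) (hn : 0 < n) (q : ℝ) (hq : 0 < q) :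
    ((∫ σ in Set.Ioi (0:ℝ), Real.exp (-q * σ^2) * wt n σ : ℝ) : ℂ) =
      (1 / (4*π*q) : ℝ) * ∫ ψ : ℝ, Set.indicator (Set.Ioc (-(n*π)) (n*π)) (fun ψ : ℝ =>
        ((Real.exp (-((n * Real.sin (ψ/2/n))^2/q)) : ℝ) : ℂ) * Complex.exp (-(Complex.I * ψ))) ψ := by
  have hn' : (0:ℝ) < n := by exact_mod_cast hn
  have hp : 0 < q / n^2 := by positivity
  have h1 : ∫ σ in Set.Ioi (0:ℝ), Real.exp (-q * σ^2) * wt n σ =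
      (n:ℝ)⁻¹ * ∫ s in Set.Ioi (0:ℝ), s * Real.exp (-(q/n^2) * s^2) * Jr n s ^ 2 := by
    have := integral_comp_mul_left_Ioi (fun s => s * Real.exp (-(q/n^2) * s^2) * Jr n s ^ 2) 0 hn'
    rw [mul_zero, smul_eq_mul] at this
    rw [← this]
    congr 1; ext σ
    have e : -(q / (n:ℝ)^2) * (n * σ)^2 = -q * σ^2 := by field_simp
    rw [e, wt]; ring
  have h2 : ((∫ s in Set.Ioi (0:ℝ), s * Real.exp (-(q/n^2) * s^2) * Jr n s ^ 2 : ℝ) : ℂ) =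
      ∫ s in Set.Ioi (0:ℝ), ((s * Real.exp (-(q/n^2) * s^2) : ℝ) : ℂ) * besselJ n s ^ 2 := by
    rw [← integral_complex_ofReal]
    congr 1; ext s
    rw [← Jr_ofReal]; push_cast; ring
  rw [h1, Complex.ofReal_mul, h2, gauss_besselJ_sq n _ hp]
  set h : ℝ → ℂ := fun φ => ((Real.exp (-(Real.sin (φ/2)^2/(q/n^2))) / (2*(q/n^2)) : ℝ) : ℂ) *
    Complex.exp (-(Complex.I * (n * φ))) with hh
  have hper : Function.Periodic h (2*π) := by
    intro φ
    simp only [hh]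
    have e1 : (φ + 2*π)/2 = φ/2 + π := by ring
    have e2 : Complex.exp (-(Complex.I * (n * ((φ + 2*π : ℝ) : ℂ)))) = Complex.exp (-(Complex.I * (n * φ))) := by
      rw [Complex.exp_eq_exp_iff_exists_int]
      exact ⟨-n, by push_cast; ring⟩
    rw [e1, Real.sin_add_pi, neg_sq, e2]
  have h3 : ∫ φ in (0:ℝ)..(2*π), h φ = ∫ φ in (-π)..π, h φ := by
    have := hper.intervalIntegral_add_eq 0 (-π)
    rw [zero_add, show -π + 2*π = π by ring] at this
    exact this
  have h4 : ∫ φ in (-π)..π, h φ = (n:ℝ)⁻¹ • ∫ ψ in (-(n*π))..(n*π), h (ψ/n) := by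
    rw [intervalIntegral.integral_comp_div h hn'.ne', smul_smul, inv_mul_cancel₀ hn'.ne', one_smul]
    congr 1 <;> field_simp
  rw [h3, h4, MeasureTheory.integral_indicator measurableSet_Ioc,
    intervalIntegral.integral_of_le (by nlinarith [mul_pos hn' Real.pi_pos])]
  have h5 : ∀ ψ : ℝ, h (ψ/n) = ((n^2/(2*q) : ℝ) : ℂ) * (((Real.exp (-((n * Real.sin (ψ/2/n))^2/q)) : ℝ) : ℂ) * Complex.exp (-(Complex.I * ψ))) := by
    intro ψ
    simp only [hh]
    have e1 : (n : ℂ) * ((ψ/n : ℝ) : ℂ) = ψ := by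
      have : (n:ℂ) ≠ 0 := by exact_mod_cast hn.ne'
      push_cast; field_simp
    have e2 : ψ/n/2 = ψ/2/n := by ring
    have e3 : Real.sin (ψ/2/n)^2/(q/n^2) = (n * Real.sin (ψ/2/n))^2/q := by field_simp
    rw [e1, e2, e3, ← mul_assoc, ← Complex.ofReal_mul]
    congr 2
    field_simp
  simp only [h5]
  rw [MeasureTheory.integral_const_mul, Complex.real_smul]
  have hnc : (n:ℂ) ≠ 0 := by exact_mod_cast hn.ne'
  have hqc : (q:ℂ) ≠ 0 := by exact_mod_cast hq.ne'
  have hpc : (π : ℂ) ≠ 0 := by exact_mod_cast Real.pi_ne_zero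
  generalize (∫ ψ in Set.Ioc (-(n*π)) (n*π), (((Real.exp (-((n * Real.sin (ψ/2/n))^2/q)) : ℝ) : ℂ) *
    Complex.exp (-(Complex.I * ψ)))) = A
  push_cast
  field_simp
  ring

open Real in
lemma moment_limit (q : ℝ) (hq : 0 < q) :
    Tendsto (fun n : ℕ => ∫ σ in Set.Ioi (0:ℝ), Real.exp (-q * σ^2) * wt n σ) atTop
      (nhds ((1/π) * ∫ y in Set.Ioi (0:ℝ), Real.exp (-q * (1 + y^2)))) := by
  have hlim : Tendsto (fun n : ℕ => ∫ ψ : ℝ, Set.indicator (Set.Ioc (-(n*π)) (n*π)) (fun ψ : ℝ =>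
        ((Real.exp (-((n * Real.sin (ψ/2/n))^2/q)) : ℝ) : ℂ) * Complex.exp (-(Complex.I * ψ))) ψ) atTop
      (nhds (∫ ψ : ℝ, ((Real.exp (-((ψ/2)^2/q)) : ℝ) : ℂ) * Complex.exp (-(Complex.I * ψ)))) := by
    have hne : ∀ ψ : ℝ, ‖Complex.exp (-(Complex.I * ψ))‖ = 1 := by
      intro ψ; rw [Complex.norm_exp]; simp
    apply tendsto_integral_of_dominated_convergence (fun ψ : ℝ => Real.exp (-(1/(π^2*q)) * ψ^2))
    · intro n
      apply AEStronglyMeasurable.indicator _ measurableSet_Ioc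
      apply Continuous.aestronglyMeasurable
      fun_prop
    · exact integrable_exp_neg_mul_sq (by positivity)
    · intro n
      refine Eventually.of_forall fun ψ => ?_
      by_cases hψ : ψ ∈ Set.Ioc (-(n*π)) (n*π)
      · rw [Set.indicator_of_mem hψ, norm_mul, hne, mul_one, Complex.norm_real, Real.norm_eq_abs,
          abs_of_pos (Real.exp_pos _)]
        apply Real.exp_le_exp.2
        have hn : (0:ℝ) < n := by
          have := hψ.1.trans_le hψ.2
          by_contra hc
          have h0 : (n:ℝ) = 0 := le_antisymm (not_lt.1 hc) (Nat.cast_nonneg n)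
          rw [h0] at this; simp at this
        have hx : |ψ/2/n| ≤ π/2 := by
          rw [abs_div, abs_div, abs_of_pos hn, abs_two, div_le_iff₀ hn]
          have : |ψ| ≤ n*π := abs_le.2 ⟨hψ.1.le, hψ.2⟩
          linarith
        have hs : 2/π * |ψ/2/n| ≤ |Real.sin (ψ/2/n)| := Real.mul_abs_le_abs_sin hx
        have hs2 : (2/π * |ψ/2/n|)^2 ≤ Real.sin (ψ/2/n)^2 := by
          rw [← sq_abs (Real.sin _)]; gcongr
        rw [mul_pow, sq_abs] at hs2
        have : 1/(π^2*q) * ψ^2 ≤ (n * Real.sin (ψ/2/n))^2/q := by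
          calc 1/(π^2*q) * ψ^2 = (n^2 * ((2/π)^2 * (ψ/2/n)^2))/q := by field_simp
            _ ≤ (n^2 * Real.sin (ψ/2/n)^2)/q := by gcongr
            _ = _ := by rw [mul_pow]
        linarith
      · rw [Set.indicator_of_notMem hψ]; simp; positivity
    · refine Eventually.of_forall fun ψ => ?_
      have hinf : Tendsto (fun n : ℕ => (n:ℝ) * π) atTop atTop :=
        tendsto_natCast_atTop_atTop.atTop_mul_const Real.pi_pos
      have hev : ∀ᶠ n : ℕ in atTop, ψ ∈ Set.Ioc (-(n*π)) (n*π) := by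
        filter_upwards [hinf.eventually_gt_atTop |ψ|] with n hn
        have := abs_lt.1 hn
        exact ⟨this.1, this.2.le⟩
      have hs : Tendsto (fun n : ℕ => (n:ℝ) * Real.sin (ψ/2/n)) atTop (nhds (ψ/2)) := by
        have h1 : Tendsto (fun n : ℕ => ψ/2 * Real.sinc (ψ/2/n)) atTop (nhds (ψ/2 * Real.sinc 0)) := by
          refine Tendsto.const_mul _ ?_
          exact (Real.continuous_sinc.tendsto 0).comp (tendsto_const_div_atTop_nhds_zero_nat _)
        rw [Real.sinc_zero, mul_one] at h1
        refine h1.congr' ?_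
        filter_upwards [eventually_gt_atTop 0] with n hn
        have hn' : (n:ℝ) ≠ 0 := by exact_mod_cast hn.ne'
        by_cases h0 : ψ = 0
        · simp [h0]
        · rw [Real.sinc_of_ne_zero (by positivity)]
          field_simp
      have hcont : Continuous (fun x : ℝ => ((Real.exp (-(x^2/q)) : ℝ) : ℂ) * Complex.exp (-(Complex.I * ψ))) := by
        fun_prop
      have := (hcont.tendsto (ψ/2)).comp hs
      refine this.congr' ?_
      filter_upwards [hev] with n hn
      rw [Set.indicator_of_mem hn]; rfl
  have hval : ∫ ψ : ℝ, ((Real.exp (-((ψ/2)^2/q)) : ℝ) : ℂ) * Complex.exp (-(Complex.I * ψ)) =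
      ((√(4*π*q) * Real.exp (-q) : ℝ) : ℂ) := by
    have := fourierIntegral_gaussian (b := ((1/(4*q) : ℝ) : ℂ)) (by rw [Complex.ofReal_re]; positivity) (-1)
    have e : ∀ ψ : ℝ, ((Real.exp (-((ψ/2)^2/q)) : ℝ) : ℂ) * Complex.exp (-(Complex.I * ψ)) =
        Complex.exp (Complex.I * (-1) * ψ) * Complex.exp (-((1/(4*q) : ℝ) : ℂ) * ψ^2) := by
      intro ψ
      rw [mul_comm]
      congr 1
      · congr 1; ring
      · push_cast; congr 1
        have hqc : (q:ℂ) ≠ 0 := by exact_mod_cast hq.ne'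
        field_simp; ring
    simp only [e]
    rw [this, Complex.ofReal_mul, Real.sqrt_eq_rpow, Complex.ofReal_cpow (by positivity)]
    have hqc : (q:ℂ) ≠ 0 := by exact_mod_cast hq.ne'
    push_cast
    congr 1
    · congr 1; field_simp
    · congr 1; field_simp
  have hR : (1/π) * ∫ y in Set.Ioi (0:ℝ), Real.exp (-q * (1 + y^2)) = (1 / (4*π*q)) * (√(4*π*q) * Real.exp (-q)) := by
    have e : ∀ y : ℝ, Real.exp (-q * (1 + y^2)) = Real.exp (-q) * Real.exp (-q * y^2) := by
      intro y; rw [← Real.exp_add]; congr 1; ring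
    simp only [e]
    rw [MeasureTheory.integral_const_mul, integral_gaussian_Ioi]
    have hpi := Real.pi_pos
    have e2 : √(π/q) = √(4*π*q) / (2*q) := by
      rw [show π/q = (4*π*q)/(2*q)^2 by field_simp; ring, Real.sqrt_div (by positivity),
        Real.sqrt_sq (by positivity)]
    rw [e2]; field_simp; ring
  rw [hR]
  have hC : Tendsto (fun n : ℕ => ((∫ σ in Set.Ioi (0:ℝ), Real.exp (-q * σ^2) * wt n σ : ℝ) : ℂ)) atTop
      (nhds (((1 / (4*π*q)) * (√(4*π*q) * Real.exp (-q)) : ℝ) : ℂ)) := by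
    rw [hval] at hlim
    rw [Complex.ofReal_mul]
    refine (hlim.const_mul (((1 / (4*π*q)) : ℝ) : ℂ)).congr' ?_
    filter_upwards [eventually_gt_atTop 0] with n hn
    rw [moment_formula n hn q hq]
  have := (Complex.continuous_re.tendsto _).comp hC
  simpa only [Function.comp_def, Complex.ofReal_re] using this

lemma intg {μ : Measure ℝ} {u w : ℝ → ℝ} (hu : Measurable u) (hu1 : ∀ x, u x ∈ Set.Icc (0:ℝ) 1)
    (hw : Integrable w μ) {a : ℝ → ℝ} (ha : Measurable a) {C : ℝ}
    (hC : ∀ t ∈ Set.Icc (0:ℝ) 1, |a t| ≤ C) : Integrable (fun x => a (u x) * w x) μ :=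
  hw.bdd_mul (c := C) (ha.comp hu).aestronglyMeasurable (Eventually.of_forall fun x => hC _ (hu1 x))

lemma est {μ : Measure ℝ} {u w : ℝ → ℝ} (hu1 : ∀ x, u x ∈ Set.Icc (0:ℝ) 1)
    (hw0 : ∀ᵐ x ∂μ, 0 ≤ w x) {a b c : ℝ → ℝ}
    (ia : Integrable (fun x => a (u x) * w x) μ) (ib : Integrable (fun x => b (u x) * w x) μ)
    (ic : Integrable (fun x => c (u x) * w x) μ)
    (h : ∀ t ∈ Set.Icc (0:ℝ) 1, |a t - b t| ≤ c t) :
    |(∫ x, a (u x) * w x ∂μ) - ∫ x, b (u x) * w x ∂μ| ≤ ∫ x, c (u x) * w x ∂μ := by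
  rw [← MeasureTheory.integral_sub ia ib, ← Real.norm_eq_abs]
  refine norm_integral_le_of_norm_le ic ?_
  filter_upwards [hw0] with x hx
  rw [← sub_mul, norm_mul, Real.norm_eq_abs, Real.norm_eq_abs, abs_of_nonneg hx]
  exact mul_le_mul_of_nonneg_right (h _ (hu1 x)) hx

lemma bdd_of_cont {g : ℝ → ℝ} (hg : Continuous g) : ∃ C, 0 < C ∧ ∀ t ∈ Set.Icc (0:ℝ) 1, |g t| ≤ C := by
  obtain ⟨C, hC⟩ := (isCompact_Icc (a := (0:ℝ)) (b := 1)).exists_bound_of_continuousOn hg.continuousOn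
  exact ⟨max C 1, by positivity, fun t ht => (hC t ht).trans (le_max_left _ _)⟩

lemma weier {μ : Measure ℝ} {u v : ℝ → ℝ} (hu : Measurable u) (hu1 : ∀ x, u x ∈ Set.Icc (0:ℝ) 1)
    (hv : Measurable v) (hv1 : ∀ x, v x ∈ Set.Icc (0:ℝ) 1)
    {w : ℕ → ℝ → ℝ} {W : ℝ → ℝ} (hw : ∀ j, Integrable (w j) μ) (hw0 : ∀ j, ∀ᵐ x ∂μ, 0 ≤ w j x)
    (hW : Integrable W μ) (hW0 : ∀ᵐ x ∂μ, 0 ≤ W x)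
    (hm : ∀ i : ℕ, Tendsto (fun j => ∫ x, u x ^ i * w j x ∂μ) atTop (nhds (∫ x, v x ^ i * W x ∂μ)))
    {g : ℝ → ℝ} (hg : Continuous g) :
    Tendsto (fun j => ∫ x, g (u x) * w j x ∂μ) atTop (nhds (∫ x, g (v x) * W x ∂μ)) := by
  have ci : ∀ {a : ℝ → ℝ}, Continuous a → ∀ j, Integrable (fun x => a (u x) * w j x) μ := by
    intro a ha j
    obtain ⟨C, _, hC⟩ := bdd_of_cont ha
    exact intg hu hu1 (hw j) ha.measurable hC
  have cI : ∀ {a : ℝ → ℝ}, Continuous a → Integrable (fun x => a (v x) * W x) μ := by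
    intro a ha
    obtain ⟨C, _, hC⟩ := bdd_of_cont ha
    exact intg hv hv1 hW ha.measurable hC
  have hpoly : ∀ P : Polynomial ℝ, Tendsto (fun j => ∫ x, P.eval (u x) * w j x ∂μ) atTop
      (nhds (∫ x, P.eval (v x) * W x ∂μ)) := by
    intro P
    induction P using Polynomial.induction_on' with
    | add P Q hP hQ =>
      have := hP.add hQ
      simp only [Polynomial.eval_add, add_mul]
      rw [MeasureTheory.integral_add (cI P.continuous) (cI Q.continuous)]
      refine this.congr fun j => ?_
      rw [MeasureTheory.integral_add (ci P.continuous j) (ci Q.continuous j)]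
    | monomial i c =>
      simp only [Polynomial.eval_monomial, mul_assoc, MeasureTheory.integral_const_mul]
      exact (hm i).const_mul c
  have hmass : Tendsto (fun j => ∫ x, w j x ∂μ) atTop (nhds (∫ x, W x ∂μ)) := by
    simpa using hm 0
  set M := (∫ x, W x ∂μ) + 1 with hM
  have hWn : 0 ≤ ∫ x, W x ∂μ := integral_nonneg_of_ae hW0
  have hMpos : 0 < M := by linarith
  rw [Metric.tendsto_atTop']
  intro ε hε
  obtain ⟨P, hP⟩ := exists_polynomial_near_of_continuousOn 0 1 g hg.continuousOn (ε/(4*M)) (by positivity)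
  have e1 := hmass.eventually_lt_const (show (∫ x, W x ∂μ) < M by linarith)
  have e2 := (Metric.tendsto_nhds.1 (hpoly P)) (ε/4) (by positivity)
  obtain ⟨N, hN⟩ := eventually_atTop.1 (e1.and e2)
  refine ⟨N, fun j hj => ?_⟩
  obtain ⟨h1, h2⟩ := hN j hj.le
  have hsub : ∀ t ∈ Set.Icc (0:ℝ) 1, |g t - P.eval t| ≤ ε/(4*M) := fun t ht => by
    rw [abs_sub_comm]; exact (hP t ht).le
  have b1 := est hu1 (hw0 j) (ci hg j) (ci P.continuous j) (c := fun _ => ε/(4*M))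
    (ci continuous_const j) hsub
  have b2 := est hv1 hW0 (cI hg) (cI P.continuous) (c := fun _ => ε/(4*M)) (cI continuous_const) hsub
  rw [MeasureTheory.integral_const_mul] at b1 b2
  have c1 : ε/(4*M) * ∫ x, w j x ∂μ ≤ ε/4 := by
    calc _ ≤ ε/(4*M) * M := by gcongr
      _ = ε/4 := by field_simp
  have c2 : ε/(4*M) * ∫ x, W x ∂μ ≤ ε/4 := by
    calc _ ≤ ε/(4*M) * M := by gcongr; linarith
      _ = ε/4 := by field_simp
  rw [Real.dist_eq] at h2 ⊢
  rw [abs_le] at b1 b2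
  rw [abs_lt] at h2 ⊢
  constructor <;> linarith [b1.1, b1.2, b2.1, b2.2, h2.1, h2.2]

lemma sandwich {μ : Measure ℝ} {u v : ℝ → ℝ} (hu : Measurable u) (hu1 : ∀ x, u x ∈ Set.Icc (0:ℝ) 1)
    (hv : Measurable v) (hv1 : ∀ x, v x ∈ Set.Icc (0:ℝ) 1)
    {w : ℕ → ℝ → ℝ} {W : ℝ → ℝ} (hw : ∀ j, Integrable (w j) μ) (hw0 : ∀ j, ∀ᵐ x ∂μ, 0 ≤ w j x)
    (hW : Integrable W μ) (hW0 : ∀ᵐ x ∂μ, 0 ≤ W x)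
    (hm : ∀ i : ℕ, Tendsto (fun j => ∫ x, u x ^ i * w j x ∂μ) atTop (nhds (∫ x, v x ^ i * W x ∂μ)))
    {g : ℝ → ℝ} (hg : Continuous g) {b : ℝ} {B : ℕ → ℝ} (hB : Tendsto B atTop (nhds b))
    (hb : ∀ᵐ x ∂μ, v x ≠ b) :
    Tendsto (fun j => ∫ x, (if B j ≤ u x then g (u x) else 0) * w j x ∂μ) atTop
      (nhds (∫ x, (if b ≤ v x then g (v x) else 0) * W x ∂μ)) := by
  have ci : ∀ {a : ℝ → ℝ}, Continuous a → ∀ j, Integrable (fun x => a (u x) * w j x) μ := by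
    intro a ha j
    obtain ⟨C, _, hC⟩ := bdd_of_cont ha
    exact intg hu hu1 (hw j) ha.measurable hC
  have cI : ∀ {a : ℝ → ℝ}, Continuous a → Integrable (fun x => a (v x) * W x) μ := by
    intro a ha
    obtain ⟨C, _, hC⟩ := bdd_of_cont ha
    exact intg hv hv1 hW ha.measurable hC
  obtain ⟨C, hC0, hC⟩ := bdd_of_cont hg
  have hsm : ∀ β : ℝ, Measurable (fun t : ℝ => if β ≤ t then g t else 0) := fun β =>
    Measurable.ite measurableSet_Ici hg.measurable measurable_const
  have hsC : ∀ β : ℝ, ∀ t ∈ Set.Icc (0:ℝ) 1, |if β ≤ t then g t else 0| ≤ C := by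
    intro β t ht
    split_ifs
    · exact hC t ht
    · simpa using hC0.le
  set T : ℝ → ℝ → ℝ := fun d t => max 0 (min 1 (2 - 2 * |t - b| / d)) with hT
  set χ : ℝ → ℝ → ℝ := fun d t => max 0 (min 1 ((t - b) / d + 1/2)) with hχ
  have hTc : ∀ d, Continuous (T d) := fun d => by simp only [hT]; fun_prop
  have hχc : ∀ d, Continuous (χ d) := fun d => by simp only [hχ]; fun_prop
  have hT0 : ∀ d t, 0 ≤ T d t := fun d t => le_max_left _ _
  have hT1 : ∀ d t, T d t ≤ 1 := fun d t => max_le zero_le_one (min_le_left _ _)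
  have key : ∀ d > 0, ∀ β, |β - b| ≤ d/2 → ∀ t ∈ Set.Icc (0:ℝ) 1,
      |(if β ≤ t then g t else 0) - χ d t * g t| ≤ C * T d t := by
    intro d hd β hβ t ht
    have hgt := hC t ht
    have hβ' := abs_le.1 hβ
    have hχ0 : 0 ≤ χ d t := le_max_left _ _
    have hχ1 : χ d t ≤ 1 := max_le zero_le_one (min_le_left _ _)
    rcases le_or_gt |t - b| (d/2) with h | h
    · have hTt : T d t = 1 := by
        simp only [hT]
        have : 2 * |t - b| / d ≤ 1 := by rw [div_le_one hd]; linarith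
        rw [min_eq_left (by linarith), max_eq_right zero_le_one]
      rw [hTt, mul_one]
      split_ifs
      · rw [← one_sub_mul, abs_mul, abs_of_nonneg (by linarith)]
        nlinarith [abs_nonneg (g t)]
      · rw [zero_sub, abs_neg, abs_mul, abs_of_nonneg hχ0]
        nlinarith [abs_nonneg (g t)]
    · have : (if β ≤ t then g t else 0) - χ d t * g t = 0 := by
        rcases lt_abs.1 h with h' | h'
        · have : χ d t = 1 := by
            simp only [hχ]
            have : 1/2 ≤ (t - b)/d := by rw [le_div_iff₀ hd]; linarith
            rw [min_eq_left (by linarith), max_eq_right zero_le_one]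
          rw [this, if_pos (by linarith)]; ring
        · have : χ d t = 0 := by
            simp only [hχ]
            have : (t - b)/d ≤ -(1/2) := by rw [div_le_iff₀ hd]; linarith
            rw [max_eq_left]
            exact (min_le_right _ _).trans (by linarith)
          rw [this, if_neg (by linarith)]; ring
      rw [this, abs_zero]
      exact mul_nonneg hC0.le (hT0 _ _)
  have hTlim : Tendsto (fun m : ℕ => ∫ x, T (1/((m:ℝ)+1)) (v x) * W x ∂μ) atTop (nhds 0) := by
    have : (0:ℝ) = ∫ x, (0:ℝ) ∂μ := by simp
    rw [this]
    apply tendsto_integral_of_dominated_convergence (fun x => |W x|)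
    · intro m; exact (cI (hTc _)).aestronglyMeasurable
    · exact hW.abs
    · intro m
      refine Eventually.of_forall fun x => ?_
      rw [norm_mul, Real.norm_eq_abs, Real.norm_eq_abs, abs_of_nonneg (hT0 _ _)]
      exact mul_le_of_le_one_left (abs_nonneg _) (hT1 _ _)
    · filter_upwards [hb] with x hx
      have hpos : 0 < |v x - b| := abs_pos.2 (sub_ne_zero.2 hx)
      have hev := (tendsto_one_div_add_atTop_nhds_zero_nat (𝕜 := ℝ)).eventually_lt_const hpos
      refine tendsto_const_nhds.congr' ?_
      filter_upwards [hev] with m hm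
      have hd : (0:ℝ) < 1/((m:ℝ)+1) := by positivity
      have : T (1/((m:ℝ)+1)) (v x) = 0 := by
        simp only [hT]
        have : 2 ≤ 2 * |v x - b| / (1/((m:ℝ)+1)) := by rw [le_div_iff₀ hd]; linarith
        rw [max_eq_left]
        exact (min_le_right _ _).trans (by linarith)
      rw [this, zero_mul]
  rw [Metric.tendsto_atTop']
  intro ε hε
  obtain ⟨m, hm'⟩ := (hTlim.eventually_lt_const (show 0 < ε/(4*C) by positivity)).exists
  set d : ℝ := 1/((m:ℝ)+1) with hd
  have hdpos : 0 < d := by positivity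
  have l1 := weier hu hu1 hv hv1 hw hw0 hW hW0 hm (hTc d)
  have l2 := weier hu hu1 hv hv1 hw hw0 hW hW0 hm ((hχc d).mul hg)
  simp only [Pi.mul_apply] at l2
  have e1 := l1.eventually_lt_const hm'
  have e2 := (Metric.tendsto_nhds.1 l2) (ε/4) (by positivity)
  have e3 := (Metric.tendsto_nhds.1 hB) (d/2) (by positivity)
  obtain ⟨N, hN⟩ := eventually_atTop.1 (e1.and (e2.and e3))
  refine ⟨N, fun j hj => ?_⟩
  obtain ⟨h1, h2, h3⟩ := hN j hj.le
  have b1 := est hu1 (hw0 j) (a := fun t => if B j ≤ t then g t else 0) (b := fun t => χ d t * g t)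
    (c := fun t => C * T d t) (intg hu hu1 (hw j) (hsm _) (hsC _)) (ci ((hχc d).mul hg) j)
    (ci (continuous_const.mul (hTc d)) j) (key d hdpos _ (by rw [← Real.dist_eq]; exact h3.le))
  have b2 := est hv1 hW0 (a := fun t => if b ≤ t then g t else 0) (b := fun t => χ d t * g t)
    (c := fun t => C * T d t) (intg hv hv1 hW (hsm _) (hsC _)) (cI ((hχc d).mul hg))
    (cI (continuous_const.mul (hTc d))) (key d hdpos _ (by rw [sub_self, abs_zero]; positivity))
  simp only [mul_assoc C, MeasureTheory.integral_const_mul] at b1 b2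
  have c1 : C * ∫ x, T d (u x) * w j x ∂μ ≤ ε/4 := by
    calc _ ≤ C * (ε/(4*C)) := by gcongr
      _ = ε/4 := by field_simp
  have c2 : C * ∫ x, T d (v x) * W x ∂μ ≤ ε/4 := by
    calc _ ≤ C * (ε/(4*C)) := by gcongr
      _ = ε/4 := by field_simp
  rw [Real.dist_eq] at h2 ⊢
  rw [abs_le] at b1 b2
  rw [abs_lt] at h2 ⊢
  constructor <;> linarith [b1.1, b1.2, b2.1, b2.2, h2.1, h2.2]

lemma cut_integral (f h : ℝ → ℝ) (lam : ℝ) (hl : 0 < lam) (P : ℝ → Prop) [DecidablePred P]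
    (hP : ∀ x, 0 < x → (P x ↔ x ≤ lam)) (e : ℝ → ℝ) (hf : ∀ x, 0 < x → x ≤ lam → e x * h x = f x) :
    ∫ x in Set.Ioi (0:ℝ), (if P x then e x else 0) * h x = ∫ x in (0:ℝ)..lam, f x := by
  rw [intervalIntegral.integral_of_le hl.le, ← Set.Ioi_inter_Iic, ← setIntegral_indicator measurableSet_Iic]
  apply setIntegral_congr_fun measurableSet_Ioi
  intro x hx
  have hx : 0 < x := hx
  by_cases h1 : x ≤ lam
  · have h2 := (hP x hx).2 h1
    have h3 : x ∈ Set.Iic lam := h1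
    simp only [h2, if_true, Set.indicator_of_mem h3]
    exact hf x hx h1
  · have h2 : ¬ P x := fun h => h1 ((hP x hx).1 h)
    have h3 : x ∉ Set.Iic lam := h1
    simp only [h2, if_false, Set.indicator_of_notMem h3, zero_mul]

lemma wt_continuous (n : ℕ) : Continuous (wt n) := by
  have := Jr_continuous n
  unfold wt; fun_prop

lemma wt_integrable (n : ℕ) : IntegrableOn (fun σ : ℝ => Real.exp (-σ^2) * wt n σ) (Set.Ioi 0) := by
  have h1 : Integrable (fun x : ℝ => x * Real.exp (-1 * x^2)) := integrable_mul_exp_neg_mul_sq one_pos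
  have h2 := (h1.const_mul (n:ℝ)).integrableOn (s := Set.Ioi (0:ℝ))
  refine Integrable.mono h2 ?_ ?_
  · have := wt_continuous n
    exact (by fun_prop : Continuous (fun σ : ℝ => Real.exp (-σ^2) * wt n σ)).aestronglyMeasurable
  · refine Eventually.of_forall fun x => ?_
    have h3 : Jr n (n*x)^2 ≤ 1 := by
      rw [← sq_abs]; exact pow_le_one₀ (abs_nonneg _) (Jr_abs_le n _)
    have : Real.exp (-x^2) * wt n x = (n * (x * Real.exp (-1 * x^2))) * Jr n (n*x)^2 := by
      rw [wt, neg_one_mul]; ring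
    rw [this, norm_mul]
    refine mul_le_of_le_one_right (norm_nonneg _) ?_
    rw [Real.norm_eq_abs, abs_of_nonneg (sq_nonneg _)]; exact h3

lemma wt_nonneg (n : ℕ) (x : ℝ) (hx : 0 ≤ x) : 0 ≤ wt n x := by
  unfold wt; positivity

open Real in
lemma wlim (L : ℝ) (hL : 1 < L) (n : ℕ → ℕ) (hn : Tendsto n atTop atTop) (lam : ℕ → ℝ)
    (hlam : Tendsto lam atTop (nhds L)) (φ : ℝ → ℝ) (hφ : Continuous φ) :
    Tendsto (fun j => ∫ σ in (0:ℝ)..(lam j), φ σ * wt (n j) σ) atTop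
      (nhds (∫ y in (0:ℝ)..(√(L^2-1)), φ (√(1+y^2)) * (1/π))) := by
  set b : ℝ := Real.exp (-L^2) with hb
  have hbpos : 0 < b := Real.exp_pos _
  have hmaxpos : ∀ t : ℝ, 0 < max t (b/2) := fun t => lt_max_of_lt_right (by positivity)
  set g : ℝ → ℝ := fun t => φ (√(-Real.log (max t (b/2)))) / max t (b/2) with hg
  have hgc : Continuous g := by
    have h1 : Continuous (fun t : ℝ => max t (b/2)) := by fun_prop
    have h2 : Continuous (fun t : ℝ => Real.log (max t (b/2))) := h1.log fun t => (hmaxpos t).ne'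
    exact (hφ.comp (Real.continuous_sqrt.comp h2.neg)).div h1 fun t => (hmaxpos t).ne'
  have hgv : ∀ s : ℝ, 0 ≤ s → b/2 ≤ Real.exp (-s^2) → g (Real.exp (-s^2)) * Real.exp (-s^2) = φ s := by
    intro s hs h
    simp only [hg]
    rw [max_eq_left h, Real.log_exp, neg_neg, Real.sqrt_sq hs, div_mul_cancel₀ _ (Real.exp_pos _).ne']
  have hB : Tendsto (fun j => Real.exp (-(lam j)^2)) atTop (nhds b) :=
    (Real.continuous_exp.tendsto _).comp ((hlam.pow 2).neg)
  have hYpos : 0 < √(L^2-1) := Real.sqrt_pos.2 (by nlinarith)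
  have hYsq : √(L^2-1)^2 = L^2-1 := Real.sq_sqrt (by nlinarith)
  have S := sandwich (μ := volume.restrict (Set.Ioi (0:ℝ))) (u := fun σ => Real.exp (-σ^2))
    (v := fun y => Real.exp (-(1+y^2))) (by fun_prop)
    (fun x => ⟨(Real.exp_pos _).le, Real.exp_le_one_iff.2 (by nlinarith)⟩) (by fun_prop)
    (fun x => ⟨(Real.exp_pos _).le, Real.exp_le_one_iff.2 (by nlinarith)⟩)
    (w := fun j σ => Real.exp (-σ^2) * wt (n j) σ) (W := fun y => (1/π) * Real.exp (-(1+y^2)))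
    (fun j => wt_integrable (n j))
    (fun j => (ae_restrict_iff' measurableSet_Ioi).2 (Eventually.of_forall fun x hx =>
      mul_nonneg (Real.exp_pos _).le (wt_nonneg _ _ (le_of_lt hx))))
    (by
      have h1 : Integrable (fun x : ℝ => Real.exp (-1 * x^2)) := integrable_exp_neg_mul_sq one_pos
      have h2 := (h1.const_mul ((1/π) * Real.exp (-1))).integrableOn (s := Set.Ioi (0:ℝ))
      refine h2.congr (Eventually.of_forall fun x => ?_)
      simp only [mul_assoc, ← Real.exp_add]
      congr 2; ring)
    (Eventually.of_forall fun x => by positivity)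
    (by
      intro i
      have h := (moment_limit (i+1) (by positivity)).comp hn
      rw [← MeasureTheory.integral_const_mul] at h
      have e1 : ∀ (s : ℝ), Real.exp (-s) ^ i * Real.exp (-s) = Real.exp (-((i:ℝ)+1) * s) := by
        intro s; rw [← Real.exp_nat_mul, ← Real.exp_add]; congr 1; ring
      have e2 : (fun x : ℝ => Real.exp (-(1+x^2)) ^ i * ((1/π) * Real.exp (-(1+x^2)))) =
          fun x : ℝ => (1/π) * Real.exp (-((i:ℝ)+1) * (1+x^2)) := by
        ext x; rw [← e1]; ring
      simp only [e2]
      refine h.congr fun j => ?_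
      simp only [Function.comp]
      congr 1; ext x
      rw [← e1]; ring)
    hgc hB
    (by
      rw [ae_restrict_iff' measurableSet_Ioi]
      have : ∀ᵐ x : ℝ, x ≠ √(L^2-1) := by simp [ae_iff]
      filter_upwards [this] with x hx hx0 h
      apply hx
      have h := Real.exp_injective h
      have hx0 : 0 < x := hx0
      rw [← Real.sqrt_sq hx0.le]; congr 1; linarith)
  have T : ∫ y in Set.Ioi (0:ℝ), (if b ≤ Real.exp (-(1+y^2)) then g (Real.exp (-(1+y^2))) else 0) *
      ((1/π) * Real.exp (-(1+y^2))) = ∫ y in (0:ℝ)..(√(L^2-1)), φ (√(1+y^2)) * (1/π) := by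
    have hP : ∀ y : ℝ, 0 < y → (b ≤ Real.exp (-(1+y^2)) ↔ y ≤ √(L^2-1)) := by
      intro y hy
      rw [hb, Real.exp_le_exp, Real.le_sqrt hy.le (by nlinarith)]
      constructor <;> intro h <;> linarith
    refine cut_integral _ (fun y => (1/π) * Real.exp (-(1+y^2))) _ hYpos _ hP (fun y => g (Real.exp (-(1+y^2)))) ?_
    intro y hy hy2
    have h1 := (hP y hy).2 hy2
    have h2 := hgv (√(1+y^2)) (Real.sqrt_nonneg _)
    rw [Real.sq_sqrt (by positivity)] at h2
    have h3 := h2 (by linarith)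
    rw [← h3]; ring
  rw [T] at S
  refine S.congr' ?_
  filter_upwards [hlam.eventually (lt_mem_nhds (show (0:ℝ) < L by linarith)),
    hB.eventually (lt_mem_nhds (show b/2 < b by linarith))] with j hj1 hj2
  have hP : ∀ y : ℝ, 0 < y → (Real.exp (-(lam j)^2) ≤ Real.exp (-y^2) ↔ y ≤ lam j) := by
    intro y hy
    rw [Real.exp_le_exp, neg_le_neg_iff, sq_le_sq₀ hy.le hj1.le]
  refine cut_integral _ (fun y => Real.exp (-y^2) * wt (n j) y) _ hj1 _ hP (fun y => g (Real.exp (-y^2))) ?_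
  intro y hy hy2
  have h1 := (hP y hy).2 hy2
  have h2 := hgv y hy.le (by linarith)
  rw [← h2]; ring

lemma Jr_small (n : ℕ) (hn : 0 < n) (x : ℝ) (hx0 : 0 ≤ x) (hx : x ≤ n/2) : |Jr n x| ≤ (3/4)^n := by
  have hn' : (0:ℝ) < n := by exact_mod_cast hn
  have hs : HasSum (fun m : ℕ => ((n:ℝ)/4)^n / (Nat.factorial n : ℝ) * (((n:ℝ)/16)^m / (Nat.factorial m : ℝ)))
      (((n:ℝ)/4)^n / (Nat.factorial n : ℝ) * Real.exp ((n:ℝ)/16)) := by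
    apply HasSum.mul_left
    rw [Real.exp_eq_exp_ℝ]
    exact NormedSpace.expSeries_div_hasSum_exp ((n:ℝ)/16)
  have h1 : ‖besselJ n (x:ℂ)‖ ≤ ((n:ℝ)/4)^n / (Nat.factorial n : ℝ) * Real.exp ((n:ℝ)/16) := by
    rw [besselJ]
    refine tsum_of_norm_bounded hs fun m => ?_
    have e : ‖((-1 : ℂ) ^ m / ((Nat.factorial m : ℂ) * (Nat.factorial (m + n) : ℂ))) *
        ((x:ℂ) / 2) ^ (2 * m + n)‖ = (x/2)^(2*m+n) / ((Nat.factorial m : ℝ) * (Nat.factorial (m+n) : ℝ)) := by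
      simp only [norm_mul, norm_div, norm_pow, norm_neg, norm_one, one_pow, Complex.norm_natCast,
        Complex.norm_real, Complex.norm_ofNat, Real.norm_eq_abs, abs_of_nonneg hx0]
      ring
    rw [e]
    have hf : (Nat.factorial n : ℝ) * (n:ℝ)^m ≤ (Nat.factorial (m+n) : ℝ) := by
      have h2 := Nat.factorial_mul_pow_le_factorial (m := n) (n := m)
      have h3 : Nat.factorial n * n^m ≤ Nat.factorial (m+n) := by
        rw [add_comm m n]
        exact le_trans (Nat.mul_le_mul_left _ (Nat.pow_le_pow_left (Nat.le_succ n) m)) h2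
      exact_mod_cast h3
    have hm : (0:ℝ) < (Nat.factorial m : ℝ) := by exact_mod_cast Nat.factorial_pos m
    have hnf : (0:ℝ) < (Nat.factorial n : ℝ) := by exact_mod_cast Nat.factorial_pos n
    calc (x/2)^(2*m+n) / ((Nat.factorial m : ℝ) * (Nat.factorial (m+n) : ℝ))
        ≤ ((n:ℝ)/4)^(2*m+n) / ((Nat.factorial m : ℝ) * ((Nat.factorial n : ℝ) * (n:ℝ)^m)) := by
          have hx4 : x/2 ≤ (n:ℝ)/4 := by linarith
          gcongr ?_ / (_ * ?_)
          exact pow_le_pow_left₀ (by positivity) hx4 _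
      _ = ((n:ℝ)/4)^n / (Nat.factorial n : ℝ) * (((n:ℝ)/16)^m / (Nat.factorial m : ℝ)) := by
          have e2 : ((n:ℝ)/4)^(2*m+n) = ((n:ℝ)/16)^m * (n:ℝ)^m * ((n:ℝ)/4)^n := by
            rw [pow_add, pow_mul, ← mul_pow]; congr 2; ring
          rw [e2]; field_simp
  rw [← Jr_ofReal, Complex.norm_real, Real.norm_eq_abs] at h1
  refine h1.trans ?_
  have h4 : (n:ℝ)^n / (Nat.factorial n : ℝ) ≤ Real.exp 1 ^ n := by
    rw [← Real.exp_nat_mul, mul_one]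
    exact Real.pow_div_factorial_le_exp _ hn'.le n
  have h5 : Real.exp ((n:ℝ)/16) = Real.exp (1/16) ^ n := by
    rw [← Real.exp_nat_mul]; congr 1; ring
  have h6 : Real.exp (1/16) ≤ 16/15 := by
    have h := Real.add_one_le_exp (-(1/16:ℝ))
    rw [Real.exp_neg] at h
    have hp := Real.exp_pos (1/16:ℝ)
    have : (15/16:ℝ) * Real.exp (1/16) ≤ 1 := by
      calc (15/16:ℝ) * Real.exp (1/16) ≤ (Real.exp (1/16))⁻¹ * Real.exp (1/16) := by gcongr; linarith
        _ = 1 := inv_mul_cancel₀ hp.ne'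
    linarith
  calc ((n:ℝ)/4)^n / (Nat.factorial n : ℝ) * Real.exp ((n:ℝ)/16)
      = (1/4)^n * ((n:ℝ)^n / (Nat.factorial n : ℝ)) * Real.exp (1/16)^n := by
        rw [h5, div_pow, div_pow, one_pow]; ring
    _ ≤ (1/4)^n * Real.exp 1 ^ n * (16/15)^n := by gcongr
    _ = ((1/4) * Real.exp 1 * (16/15))^n := by rw [mul_pow, mul_pow]
    _ ≤ (3/4)^n := by
        gcongr
        have := Real.exp_one_lt_d9
        linarith

/-- remainder density -/
noncomputable def rmd (n : ℕ) (σ : ℝ) : ℝ := n * Jr n (n*σ)^2 * (1 - σ / max σ (1/2))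

lemma rmd_bound (n : ℕ) (hn : 0 < n) (σ : ℝ) (h0 : 0 ≤ σ) : |rmd n σ| ≤ n * (9/16)^n := by
  have hn' : (0:ℝ) < n := by exact_mod_cast hn
  unfold rmd
  by_cases h : σ ≤ 1/2
  · have h1 := Jr_small n hn (n*σ) (by positivity) (by nlinarith)
    have h2 : Jr n (n*σ)^2 ≤ (9/16)^n := by
      rw [← sq_abs]
      calc |Jr n (n*σ)|^2 ≤ ((3/4)^n)^2 := by gcongr
        _ = (9/16)^n := by rw [← pow_mul, mul_comm, pow_mul]; norm_num
    rw [max_eq_right h, abs_mul, abs_mul, abs_of_pos hn', abs_of_nonneg (sq_nonneg _)]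
    have h3 : |1 - σ/(1/2)| ≤ 1 := by rw [abs_le]; constructor <;> linarith
    calc (n:ℝ) * Jr n (n*σ)^2 * |1 - σ/(1/2)| ≤ n * (9/16)^n * 1 := by gcongr
      _ = _ := mul_one _
  · push Not at h
    rw [max_eq_left h.le, div_self (by linarith), sub_self, mul_zero, abs_zero]
    positivity

lemma rmd_continuous (n : ℕ) : Continuous (rmd n) := by
  have := Jr_continuous n
  have h : Continuous (fun σ : ℝ => σ / max σ (1/2)) :=
    continuous_id.div (by fun_prop) fun t => (lt_max_of_lt_right (by norm_num)).ne'
  unfold rmd; fun_prop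

lemma rmd_lim (L : ℝ) (hL : 1 < L) (n : ℕ → ℕ) (hn : Tendsto n atTop atTop) (lam : ℕ → ℝ)
    (hlam : Tendsto lam atTop (nhds L)) :
    Tendsto (fun j => ∫ σ in (0:ℝ)..(lam j), rmd (n j) σ) atTop (nhds 0) := by
  have h1 : Tendsto (fun n : ℕ => (n:ℝ) * (9/16)^n) atTop (nhds 0) :=
    tendsto_self_mul_const_pow_of_lt_one (by norm_num) (by norm_num)
  have h2 := (h1.comp hn).mul hlam
  rw [zero_mul] at h2
  refine squeeze_zero_norm' ?_ h2
  filter_upwards [hlam.eventually (lt_mem_nhds (show (0:ℝ) < L by linarith)),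
    hn.eventually (eventually_gt_atTop 0)] with j hj1 hj2
  have := intervalIntegral.norm_integral_le_of_norm_le_const (a := 0) (b := lam j) (f := rmd (n j))
    (C := (n j:ℝ) * (9/16)^(n j)) (fun x hx => by
      rw [Set.uIoc_of_le hj1.le] at hx
      exact rmd_bound _ hj2 _ hx.1.le)
  rwa [sub_zero, abs_of_pos hj1] at this

lemma real_identity (n : ℕ) (lam : ℝ) (hl : 0 < lam) :
    ((n * lam : ℝ) : ℂ) * BornB n ((n * lam : ℝ) : ℂ) =
      (((1/lam) * (∫ σ in (0:ℝ)..lam, 1 * wt n σ) + (∫ σ in (0:ℝ)..lam, (1 / max σ (1/2)) * wt n σ) +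
        ∫ σ in (0:ℝ)..lam, rmd n σ : ℝ) : ℂ) := by
  have hJ := Jr_continuous n
  have hw := wt_continuous n
  have hmx : Continuous (fun σ : ℝ => 1 / max σ (1/2)) :=
    continuous_const.div (by fun_prop) fun t => (lt_max_of_lt_right (by norm_num)).ne'
  have h1 : BornB n ((n * lam : ℝ) : ℂ) = ((∫ t in (0:ℝ)..1, (t+1) * Jr n (n*lam*t)^2 : ℝ) : ℂ) := by
    rw [BornB, ← intervalIntegral.integral_ofReal]
    congr 1; ext t
    rw [← Complex.ofReal_mul, ← Jr_ofReal]; push_cast; rfl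
  rw [h1, ← Complex.ofReal_mul]
  congr 1
  have h2 := intervalIntegral.mul_integral_comp_mul_left (a := 0) (b := 1)
    (f := fun σ => (σ/lam+1) * Jr n (n*σ)^2) lam
  rw [mul_zero, mul_one] at h2
  have h3 : ∀ t : ℝ, (lam*t/lam+1) * Jr n (n*(lam*t))^2 = (t+1) * Jr n (n*lam*t)^2 := by
    intro t; rw [mul_div_cancel_left₀ _ hl.ne', mul_assoc]
  simp only [h3] at h2
  rw [mul_assoc, h2, ← intervalIntegral.integral_const_mul, ← intervalIntegral.integral_const_mul,
    ← intervalIntegral.integral_add, ← intervalIntegral.integral_add]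
  · congr 1; ext σ
    unfold wt rmd
    have : max σ (1/2) ≠ 0 := (lt_max_of_lt_right (by norm_num)).ne'
    field_simp
    ring
  · exact Continuous.intervalIntegrable (by fun_prop) _ _
  · exact (rmd_continuous n).intervalIntegrable _ _
  · exact Continuous.intervalIntegrable (by fun_prop) _ _
  · exact Continuous.intervalIntegrable (by fun_prop) _ _

open Real in
lemma target_integral (L : ℝ) (hL : 1 < L) :
    ∫ t in (1:ℝ)..L, ((t / L) + 1) / √(t ^ 2 - 1) = √(L^2-1)/L + Real.arsinh (√(L^2-1)) := by
  have hd : ∀ t ∈ Set.Ioo 1 L, HasDerivAt (fun t : ℝ => √(t^2-1)/L + Real.arsinh (√(t^2-1)))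
      (((t / L) + 1) / √(t ^ 2 - 1)) t := by
    intro t ht
    have hp : 0 < t^2-1 := by nlinarith [ht.1]
    have h1 : HasDerivAt (fun t : ℝ => t^2-1) (2*t) t := by
      have := (hasDerivAt_pow 2 t).sub_const 1
      simpa using this
    have h2 := h1.sqrt hp.ne'
    have h3 := (h2.div_const L).add h2.arsinh
    refine h3.congr_deriv ?_
    have h4 : √(1 + √(t^2-1)^2) = t := by
      rw [Real.sq_sqrt hp.le, show 1 + (t^2-1) = t^2 by ring, Real.sqrt_sq (by linarith [ht.1])]
    have hs : √(t^2-1) ≠ 0 := (Real.sqrt_pos.2 hp).ne'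
    have ht0 : t ≠ 0 := by linarith [ht.1]
    have hL0 : L ≠ 0 := by linarith
    rw [h4, smul_eq_mul]
    field_simp
  have hc : ContinuousOn (fun t : ℝ => √(t^2-1)/L + Real.arsinh (√(t^2-1))) (Set.Icc 1 L) := by
    have : Continuous (fun t : ℝ => √(t^2-1)/L + Real.arsinh (√(t^2-1))) :=
      Continuous.add (by fun_prop) (Real.continuous_arsinh.comp (by fun_prop))
    exact this.continuousOn
  have hi : IntervalIntegrable (fun t : ℝ => ((t / L) + 1) / √(t ^ 2 - 1)) volume 1 L := by
    rw [intervalIntegrable_iff_integrableOn_Ioc_of_le hL.le]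
    refine intervalIntegral.integrableOn_deriv_of_nonneg hc hd fun t ht => ?_
    have : 0 < t := by linarith [ht.1]
    positivity
  rw [intervalIntegral.integral_eq_sub_of_hasDerivAt_of_le hL.le hc hd hi]
  simp

open Real in
lemma arsinh_integral (Y : ℝ) : ∫ y in (0:ℝ)..Y, 1 / √(1+y^2) = Real.arsinh Y := by
  rw [intervalIntegral.integral_eq_sub_of_hasDerivAt (f := Real.arsinh)]
  · simp
  · intro x _
    rw [one_div]; exact Real.hasDerivAt_arsinh x
  · apply Continuous.intervalIntegrable
    exact continuous_const.div (by fun_prop) fun t => (Real.sqrt_pos.2 (by positivity)).ne'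

theorem stmt_19 (L : ℝ) (hL : 1 < L)
    (n : ℕ → ℕ) (hn : ∀ j, 0 < n j)
    (hn' : Tendsto (fun j => (n j : ℝ)) atTop atTop)
    (k : ℕ → ℂ)
    (him : Tendsto (fun j => (k j).im) atTop (nhds 0))
    (hratio : Tendsto (fun j => k j / (n j : ℂ)) atTop (nhds (L : ℂ))) :
    Tendsto (fun j => k j * BornB (n j) (k j)) atTop
        (nhds (((1 / Real.pi) * ∫ t in (1:ℝ)..L, ((t / L) + 1) / Real.sqrt (t ^ 2 - 1) : ℝ) : ℂ)) ∧
      ∀ᶠ j in atTop, BornB (n j) (k j) ≠ 0 := by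
  have hnn : Tendsto n atTop atTop := tendsto_natCast_atTop_iff.1 hn'
  have hYpos : 0 < √(L^2-1) := Real.sqrt_pos.2 (by nlinarith)
  set lam : ℕ → ℝ := fun j => (k j).re / n j with hlamdef
  have hlam : Tendsto lam atTop (nhds L) := by
    have h := (Complex.continuous_re.tendsto _).comp hratio
    rw [Complex.ofReal_re] at h
    refine h.congr fun j => ?_
    simp only [Function.comp, hlamdef]
    rw [Complex.div_natCast_re]
  have hmx : Continuous (fun σ : ℝ => 1 / max σ (1/2)) :=
    continuous_const.div (by fun_prop) fun t => (lt_max_of_lt_right (by norm_num)).ne'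
  have W1 := wlim L hL n hnn lam hlam (fun _ => 1) continuous_const
  have W2 := wlim L hL n hnn lam hlam _ hmx
  have W3 := rmd_lim L hL n hnn lam hlam
  have hinv : Tendsto (fun j => 1 / lam j) atTop (nhds (1/L)) := by
    exact tendsto_const_nhds.div hlam (by linarith)
  have W := ((hinv.mul W1).add W2).add W3
  have hval : (1/L * (∫ y in (0:ℝ)..(√(L^2-1)), 1 * (1/Real.pi)) +
      ∫ y in (0:ℝ)..(√(L^2-1)), 1 / max (√(1+y^2)) (1/2) * (1/Real.pi)) + 0 =
      (1 / Real.pi) * ∫ t in (1:ℝ)..L, ((t / L) + 1) / Real.sqrt (t ^ 2 - 1) := by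
    have hm : ∀ y : ℝ, max (√(1+y^2)) (1/2) = √(1+y^2) := by
      intro y
      apply max_eq_left
      have : (1:ℝ) ≤ √(1+y^2) := Real.one_le_sqrt.2 (by nlinarith)
      linarith
    simp only [hm]
    rw [intervalIntegral.integral_mul_const, intervalIntegral.integral_mul_const,
      intervalIntegral.integral_const, arsinh_integral,
      target_integral L hL, smul_eq_mul]
    ring
  rw [hval] at W
  have hT : Tendsto (fun j => k j * BornB (n j) (k j)) atTop
        (nhds (((1 / Real.pi) * ∫ t in (1:ℝ)..L, ((t / L) + 1) / Real.sqrt (t ^ 2 - 1) : ℝ) : ℂ)) := by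
    have WC := (Complex.continuous_ofReal.tendsto _).comp W
    have hz : Tendsto (fun j => k j * BornB (n j) (k j) - ((k j).re : ℂ) * BornB (n j) ((k j).re : ℂ))
        atTop (nhds 0) := by
      have h1 : Tendsto (fun j => 3 * Real.exp 2 * |(k j).im|) atTop (nhds 0) := by
        have := (him.abs).const_mul (3 * Real.exp 2)
        simpa using this
      refine squeeze_zero_norm' ?_ h1
      have h2 : Tendsto (fun j => |(k j).im|) atTop (nhds 0) := by simpa using him.abs
      filter_upwards [h2.eventually (gt_mem_nhds one_pos)] with j hj
      exact reduce_real (n j) (k j) hj.le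
    have WS := hz.add WC
    rw [zero_add] at WS
    refine WS.congr' ?_
    filter_upwards [hlam.eventually (lt_mem_nhds (show (0:ℝ) < L by linarith))] with j hj
    have hnj : (n j : ℝ) ≠ 0 := by exact_mod_cast (hn j).ne'
    have e : (n j : ℝ) * lam j = (k j).re := by simp only [hlamdef]; field_simp
    have h := real_identity (n j) (lam j) hj
    rw [e] at h
    simp only [Function.comp]
    rw [← h]; ring
  refine ⟨hT, ?_⟩
  have hne : (((1 / Real.pi) * ∫ t in (1:ℝ)..L, ((t / L) + 1) / Real.sqrt (t ^ 2 - 1) : ℝ) : ℂ) ≠ 0 := by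
    rw [Complex.ofReal_ne_zero, target_integral L hL]
    have h1 : 0 < Real.arsinh (√(L^2-1)) := Real.arsinh_pos_iff.2 hYpos
    have h2 : 0 < L := by linarith
    have := Real.pi_pos
    positivity
  filter_upwards [hT.eventually_ne hne] with j hj h0
  exact hj (by rw [h0, mul_zero])
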